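/- Let G be a finite simple graph without isolated vertices and let k ≥ 0 be an integer. If G has an edge clique cover with at most α(G) + k cliques, then G has at least α(G) − k distinct simplicial cliques, i.e., |{N[v] : v is a simplicial vertex of G}| ≥ α(G) − k. -/

import Mathlib

def IsIndepFinset {V : Type*} (G : SimpleGraph V) (s : Finset V) : Prop :=
  (s : Set V).Pairwise fun u v => ¬ G.Adj u v

/-- `graphAlpha G` is the maximum size of an independent set of `G`. -/
noncomputable def graphAlpha {V : Type*} [Fintype V] (G : SimpleGraph V) : ℕ :=
  sSup {n | ∃ s : Finset V, IsIndepFinset G s ∧ s.card = n}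

/-- A family of cliques of `G` such that every edge of `G` has both endpoints in at
least one clique of the family. -/
def IsEdgeCliqueCover {V : Type*} (G : SimpleGraph V) (𝒞 : Finset (Finset V)) : Prop :=
  (∀ C ∈ 𝒞, G.IsClique (C : Set V)) ∧
    ∀ u v, G.Adj u v → ∃ C ∈ 𝒞, u ∈ C ∧ v ∈ C

/-- A vertex is simplicial if its closed neighborhood `N[v] = {v} ∪ N(v)` is a clique. -/
def IsSimplicialVtx {V : Type*} (G : SimpleGraph V) (v : V) : Prop :=
  G.IsClique (insert v (G.neighborSet v))

open scoped Classical in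
/-- The set `𝒮 = {N[v] : v a simplicial vertex of G}` of distinct simplicial cliques. -/
noncomputable def simplicialCliques {V : Type*} [Fintype V] (G : SimpleGraph V) :
    Finset (Finset V) :=
  (Finset.univ.filter fun v => IsSimplicialVtx G v).image
    fun v => insert v (G.neighborFinset v)

lemma exists_isIndepFinset_card_eq_graphAlpha {V : Type*} [Fintype V] (G : SimpleGraph V) :
    ∃ s : Finset V, IsIndepFinset G s ∧ s.card = graphAlpha G :=
  Nat.sSup_mem (s := {n | ∃ s : Finset V, IsIndepFinset G s ∧ s.card = n})
    ⟨0, ∅, by simp [IsIndepFinset], rfl⟩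
    ⟨Fintype.card V, by rintro _ ⟨s, -, rfl⟩; exact s.card_le_univ⟩

/-- A vertex lying in only one member of an edge clique cover is simplicial. -/
lemma IsEdgeCliqueCover.isSimplicialVtx {V : Type*} [Fintype V] [DecidableEq V]
    {G : SimpleGraph V} {𝒞 : Finset (Finset V)} (h : IsEdgeCliqueCover G 𝒞) {v : V}
    (hv : (𝒞.filter (v ∈ ·)).card = 1) : IsSimplicialVtx G v := by
  obtain ⟨C, hC⟩ := Finset.card_eq_one.mp hv
  have hCmem : C ∈ 𝒞.filter (v ∈ ·) := by simp [hC]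
  rw [Finset.mem_filter] at hCmem
  refine (h.1 C hCmem.1).subset ?_
  rintro u (rfl | hu)
  · exact hCmem.2
  · obtain ⟨D, hD, hvD, huD⟩ := h.2 v u hu
    have hDC : D ∈ 𝒞.filter (v ∈ ·) := Finset.mem_filter.mpr ⟨hD, hvD⟩
    rw [hC, Finset.mem_singleton] at hDC
    exact hDC ▸ huD

/-- Distinct vertices of an independent set lie in disjoint sets of cliques. -/
lemma IsEdgeCliqueCover.sum_card_filter_mem_le {V : Type*} [Fintype V] [DecidableEq V]
    {G : SimpleGraph V} {𝒞 : Finset (Finset V)} (h : IsEdgeCliqueCover G 𝒞) {s : Finset V}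
    (hs : IsIndepFinset G s) : ∑ v ∈ s, (𝒞.filter (v ∈ ·)).card ≤ 𝒞.card := by
  rw [← Finset.card_biUnion]
  · exact Finset.card_le_card (Finset.biUnion_subset.mpr fun _ _ => Finset.filter_subset _ _)
  · intro u hu v hv huv
    refine Finset.disjoint_left.mpr fun C hCu hCv => hs hu hv huv ?_
    rw [Finset.mem_filter] at hCu hCv
    exact h.1 C hCu.1 hCu.2 hCv.2 huv

/-- Nonadjacent simplicial vertices have distinct closed neighborhoods. -/
lemma card_le_card_simplicialCliques {V : Type*} [Fintype V] {G : SimpleGraph V}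
    {s : Finset V} (hs : IsIndepFinset G s) (hsimp : ∀ v ∈ s, IsSimplicialVtx G v) :
    s.card ≤ (simplicialCliques G).card := by
  classical
  refine Finset.card_le_card_of_injOn (fun v => insert v (G.neighborFinset v)) ?_ ?_
  · intro v hv
    simp only [simplicialCliques, Finset.mem_coe, Finset.mem_image, Finset.mem_filter,
      Finset.mem_univ, true_and]
    exact ⟨v, hsimp v hv, by ext; simp⟩
  · intro u hu v hv huv
    by_contra hne
    have hmem := Finset.mem_insert_self u (G.neighborFinset u)
    beta_reduce at huv
    rw [huv] at hmem
    rw [Finset.mem_insert, SimpleGraph.mem_neighborFinset] at hmem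
    exact hs hu hv hne (hmem.resolve_left hne).symm

/-- If `G` has no isolated vertices and admits an edge clique cover with at
most `α(G) + k` cliques, then `G` has at least `α(G) - k` distinct simplicial cliques. -/
theorem simplicial_cliques_ge {V : Type*} [Fintype V] [DecidableEq V]
    (G : SimpleGraph V) (k : ℕ)
    (hiso : ∀ v : V, ∃ u, G.Adj v u)
    (hcov : ∃ 𝒞 : Finset (Finset V), IsEdgeCliqueCover G 𝒞 ∧ 𝒞.card ≤ graphAlpha G + k) :
    (graphAlpha G : ℤ) - (k : ℤ) ≤ ((simplicialCliques G).card : ℤ) := by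
  obtain ⟨𝒞, h𝒞, hcard⟩ := hcov
  obtain ⟨s, hs, hsα⟩ := exists_isIndepFinset_card_eq_graphAlpha G
  set t := s.filter fun v => (𝒞.filter (v ∈ ·)).card = 1 with ht
  have htS : t.card ≤ (simplicialCliques G).card := by
    refine card_le_card_simplicialCliques
      (hs.mono (Finset.coe_subset.mpr (Finset.filter_subset _ _))) fun v hv => ?_
    exact h𝒞.isSimplicialVtx (Finset.mem_filter.mp hv).2
  have hpos (v : V) : 1 ≤ (𝒞.filter (v ∈ ·)).card := by
    obtain ⟨u, hu⟩ := hiso v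
    obtain ⟨C, hC, hvC, -⟩ := h𝒞.2 v u hu
    exact Finset.card_pos.mpr ⟨C, Finset.mem_filter.mpr ⟨hC, hvC⟩⟩
  have hsum : ∑ _v ∈ s, 2 ≤
      ∑ v ∈ s, ((𝒞.filter (v ∈ ·)).card + if (𝒞.filter (v ∈ ·)).card = 1 then 1 else 0) := by
    refine Finset.sum_le_sum fun v _ => ?_
    have := hpos v
    split_ifs <;> omega
  rw [Finset.sum_add_distrib, ← Finset.card_filter, ← ht, Finset.sum_const, smul_eq_mul] at hsum
  have := h𝒞.sum_card_filter_mem_le hs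
  omega
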